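/- Let W be a classical-quantum channel with input alphabet X = {1,…,k} and output dimension d such that each W(i) is positive definite, let p be a probability vector on X with W_p := ∑_i p_i W(i), and let R be a real number. Then sup_{0≤t<1} [ −log(∑_{i=1}^k p_i Tr[W(i)^{1−t} W_p^t]) − tR ] ≥ sup_{0≤t<1} (φ_{W,p}(t) − tR)/(1+t). That is, the exponent max_{0≤t<1}(φ_{W,p}(t) − tR)/(1+t) is no larger than the exponent max_{0≤t<1}(−log ∑_i p_i Tr[W(i)^{1−t} W_p^t] − tR). -/

import Mathlib

open Matrix
open scoped ComplexOrder

open Classical in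
/-- The power `A^s` of a positive semidefinite (more generally Hermitian) matrix,
obtained by applying `x ↦ x ^ s` to the eigenvalues in a spectral decomposition. -/
noncomputable def matRpow {ι : Type*} [Fintype ι] [DecidableEq ι]
    (A : Matrix ι ι ℂ) (s : ℝ) : Matrix ι ι ℂ :=
  if hA : A.IsHermitian then
    (hA.eigenvectorUnitary : Matrix ι ι ℂ) *
      Matrix.diagonal (fun i => ((hA.eigenvalues i ^ s : ℝ) : ℂ)) *
      star (hA.eigenvectorUnitary : Matrix ι ι ℂ)
  else 0

/-- `φ_{W,p}(t) = -(1-t) log Tr[(∑ᵢ pᵢ W(i)^{1-t})^{1/(1-t)}]`. -/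
noncomputable def phiW {k d : ℕ} (W : Fin k → Matrix (Fin d) (Fin d) ℂ)
    (p : Fin k → ℝ) (t : ℝ) : ℝ :=
  -(1 - t) * Real.log
    ((matRpow (∑ i, (p i : ℂ) • matRpow (W i) (1 - t)) (1 / (1 - t))).trace.re)

lemma matRpow_eq {ι : Type*} [Fintype ι] [DecidableEq ι] {A : Matrix ι ι ℂ}
    (hA : A.IsHermitian) (s : ℝ) :
    matRpow A s = (hA.eigenvectorUnitary : Matrix ι ι ℂ) *
      Matrix.diagonal (fun i => ((hA.eigenvalues i ^ s : ℝ) : ℂ)) *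
      star (hA.eigenvectorUnitary : Matrix ι ι ℂ) := by
  unfold matRpow
  rw [dif_pos hA]

lemma matRpow_one {ι : Type*} [Fintype ι] [DecidableEq ι] {A : Matrix ι ι ℂ}
    (hA : A.IsHermitian) : matRpow A 1 = A := by
  rw [matRpow_eq hA]
  conv_rhs => rw [hA.spectral_theorem, Unitary.conjStarAlgAut_apply]
  simp [Function.comp_def]

lemma posDef_matRpow {ι : Type*} [Fintype ι] [DecidableEq ι] {A : Matrix ι ι ℂ}
    (hA : A.PosDef) (s : ℝ) : (matRpow A s).PosDef := by
  rw [matRpow_eq hA.isHermitian]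
  have hD : (Matrix.diagonal (fun i => ((hA.isHermitian.eigenvalues i ^ s : ℝ) : ℂ))).PosDef := by
    rw [Matrix.posDef_diagonal_iff]
    intro i
    exact_mod_cast Real.rpow_pos_of_pos (hA.eigenvalues_pos i) s
  refine hD.mul_mul_conjTranspose_same ?_
  exact Matrix.vecMul_injective_of_isUnit (Unitary.isUnit_coe)

lemma re_trace_matRpow {ι : Type*} [Fintype ι] [DecidableEq ι] {A : Matrix ι ι ℂ}
    (hA : A.IsHermitian) (s : ℝ) :
    (matRpow A s).trace.re = ∑ a, hA.eigenvalues a ^ s := by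
  rw [matRpow_eq hA, Matrix.trace_mul_cycle, Unitary.coe_star_mul_self]
  simp [Matrix.trace]

/-- The squared moduli of the overlaps of two eigenbases. -/
noncomputable def eigenOverlap {ι : Type*} [Fintype ι] [DecidableEq ι] {A B : Matrix ι ι ℂ}
    (hA : A.IsHermitian) (hB : B.IsHermitian) (a b : ι) : ℝ :=
  Complex.normSq ((star (hA.eigenvectorUnitary : Matrix ι ι ℂ) *
    (hB.eigenvectorUnitary : Matrix ι ι ℂ)) a b)

lemma eigenOverlap_nonneg {ι : Type*} [Fintype ι] [DecidableEq ι] {A B : Matrix ι ι ℂ}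
    (hA : A.IsHermitian) (hB : B.IsHermitian) (a b : ι) : 0 ≤ eigenOverlap hA hB a b :=
  Complex.normSq_nonneg _

lemma sum_eigenOverlap_right {ι : Type*} [Fintype ι] [DecidableEq ι] {A B : Matrix ι ι ℂ}
    (hA : A.IsHermitian) (hB : B.IsHermitian) (a : ι) : ∑ b, eigenOverlap hA hB a b = 1 := by
  set M := star hA.eigenvectorUnitary * hB.eigenvectorUnitary with hM
  have h := congrFun (congrFun (Unitary.coe_mul_star_self M) a) a
  rw [Matrix.mul_apply] at h
  simp only [Unitary.coe_star, Matrix.star_apply, Complex.star_def, Complex.mul_conj] at h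
  have h' := congrArg Complex.re h
  simpa [eigenOverlap, hM] using h'

lemma sum_eigenOverlap_left {ι : Type*} [Fintype ι] [DecidableEq ι] {A B : Matrix ι ι ℂ}
    (hA : A.IsHermitian) (hB : B.IsHermitian) (b : ι) : ∑ a, eigenOverlap hA hB a b = 1 := by
  set M := star hA.eigenvectorUnitary * hB.eigenvectorUnitary with hM
  have h := congrFun (congrFun (Unitary.coe_star_mul_self M) b) b
  rw [Matrix.mul_apply] at h
  simp only [Matrix.star_apply, Complex.star_def, ← Complex.normSq_eq_conj_mul_self] at h
  have h' := congrArg Complex.re h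
  simpa [eigenOverlap, hM] using h'

lemma re_trace_matRpow_mul_matRpow {ι : Type*} [Fintype ι] [DecidableEq ι] {A B : Matrix ι ι ℂ}
    (hA : A.IsHermitian) (hB : B.IsHermitian) (s t : ℝ) :
    (matRpow A s * matRpow B t).trace.re =
      ∑ a, ∑ b, eigenOverlap hA hB a b * (hA.eigenvalues a ^ s * hB.eigenvalues b ^ t) := by
  rw [matRpow_eq hA, matRpow_eq hB]
  set U := (hA.eigenvectorUnitary : Matrix ι ι ℂ) with hU
  set V := (hB.eigenvectorUnitary : Matrix ι ι ℂ) with hV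
  set D := Matrix.diagonal (fun i => ((hA.eigenvalues i ^ s : ℝ) : ℂ))
  set E := Matrix.diagonal (fun i => ((hB.eigenvalues i ^ t : ℝ) : ℂ))
  have h : (U * D * star U * (V * E * star V)).trace =
      ((D * (star U * V)) * (E * star (star U * V))).trace := by
    rw [star_mul, star_star, Matrix.mul_assoc U, Matrix.mul_assoc U, Matrix.trace_mul_comm U]
    simp only [Matrix.mul_assoc]
  rw [h, Matrix.trace]
  simp only [Matrix.diag_apply, Matrix.mul_apply (M := D * (star U * V)), D, E,
    Matrix.diagonal_mul, Matrix.star_apply, Complex.re_sum]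
  refine Finset.sum_congr rfl fun a _ => Finset.sum_congr rfl fun b _ => ?_
  rw [eigenOverlap, ← hU, ← hV, Complex.star_def, mul_mul_mul_comm, Complex.mul_conj,
    ← Complex.ofReal_mul, ← Complex.ofReal_mul, Complex.ofReal_re, mul_comm]

lemma posDef_sum_smul {κ ι : Type*} [Fintype κ] [Fintype ι] [DecidableEq ι]
    {M : κ → Matrix ι ι ℂ} (hM : ∀ i, (M i).PosDef) {p : κ → ℝ} (hp : ∀ i, 0 ≤ p i)
    (hp1 : ∑ i, p i = 1) : (∑ i, (p i : ℂ) • M i).PosDef := by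
  classical
  obtain ⟨j, -, hj⟩ : ∃ j ∈ Finset.univ, 0 < p j :=
    Finset.exists_lt_of_sum_lt (by simp [hp1])
  rw [← Finset.add_sum_erase _ _ (Finset.mem_univ j)]
  refine ((hM j).smul (by exact_mod_cast hj)).add_posSemidef ?_
  exact Matrix.posSemidef_sum _ fun i _ => (hM i).posSemidef.smul (by exact_mod_cast hp i)

/-- The trace Hölder inequality `Tr[A Bᵗ] ≤ (Tr A^{1/(1-t)})^{1-t}` for `Tr B = 1`. -/
lemma re_trace_mul_matRpow_le {ι : Type*} [Fintype ι] [DecidableEq ι] [Nonempty ι]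
    {A B : Matrix ι ι ℂ} (hA : A.PosDef) (hB : B.PosDef) (hB1 : B.trace = 1) {t : ℝ}
    (ht0 : 0 ≤ t) (ht1 : t < 1) :
    0 < (matRpow A (1 / (1 - t))).trace.re ∧ (A * matRpow B t).trace.re ≤
      (matRpow A (1 / (1 - t))).trace.re ^ (1 - t) := by
  have hB1' : ∑ b, hB.isHermitian.eigenvalues b = 1 := by
    have h := re_trace_matRpow hB.isHermitian 1
    rw [matRpow_one hB.isHermitian, hB1] at h
    simpa using h.symm
  have key := re_trace_matRpow_mul_matRpow hA.isHermitian hB.isHermitian 1 t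
  rw [matRpow_one hA.isHermitian] at key
  rw [key, re_trace_matRpow hA.isHermitian]
  set α := hA.isHermitian.eigenvalues
  set β := hB.isHermitian.eigenvalues
  set w := eigenOverlap hA.isHermitian hB.isHermitian
  set S := ∑ a, α a ^ (1 / (1 - t)) with hS
  have hα : ∀ a, 0 < α a := hA.eigenvalues_pos
  have hβ : ∀ b, 0 < β b := hB.eigenvalues_pos
  have hSpos : 0 < S :=
    Finset.sum_pos (fun a _ => Real.rpow_pos_of_pos (hα a) _) Finset.univ_nonempty
  refine ⟨hSpos, ?_⟩
  have ht : 0 < 1 - t := by linarith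
  have young : ∀ a b, α a ^ (1 : ℝ) * β b ^ t ≤
      S ^ (1 - t) * ((1 - t) * (α a ^ (1 / (1 - t)) / S) + t * β b) := by
    intro a b
    have hp : 0 < α a ^ (1 / (1 - t)) := Real.rpow_pos_of_pos (hα a) _
    have h := Real.geom_mean_le_arith_mean2_weighted ht.le ht0 (div_pos hp hSpos).le (hβ b).le
      (by ring)
    rw [Real.div_rpow hp.le hSpos.le, ← Real.rpow_mul (hα a).le, one_div_mul_cancel ht.ne',
      div_mul_eq_mul_div, div_le_iff₀ (Real.rpow_pos_of_pos hSpos _)] at h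
    linarith
  calc ∑ a, ∑ b, w a b * (α a ^ (1 : ℝ) * β b ^ t)
      ≤ ∑ a, ∑ b, w a b * (S ^ (1 - t) * ((1 - t) * (α a ^ (1 / (1 - t)) / S) + t * β b)) :=
        Finset.sum_le_sum fun a _ => Finset.sum_le_sum fun b _ =>
          mul_le_mul_of_nonneg_left (young a b) (eigenOverlap_nonneg _ _ a b)
    _ = S ^ (1 - t) * ((1 - t) / S * (∑ a, (∑ b, w a b) * α a ^ (1 / (1 - t))) +
          t * ∑ b, (∑ a, w a b) * β b) := by
        simp only [Finset.sum_mul, Finset.mul_sum, mul_add]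
        rw [Finset.sum_comm (s := Finset.univ) (t := Finset.univ) (f := fun b a => _ * (t * _)),
          ← Finset.sum_add_distrib]
        refine Finset.sum_congr rfl fun a _ => ?_
        rw [← Finset.sum_add_distrib]
        refine Finset.sum_congr rfl fun b _ => ?_
        ring
    _ = S ^ (1 - t) := by
        have h1 : ∀ a, ∑ b, w a b = 1 := sum_eigenOverlap_right _ _
        have h2 : ∀ b, ∑ a, w a b = 1 := sum_eigenOverlap_left _ _
        simp only [h1, h2, one_mul, ← hS, hB1']
        field_simp
        ring

/-- Log-convexity of `s ↦ ∑ᵢ pᵢ Tr[W(i)^{1-s} Bˢ]` between `0` and `t`. -/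
lemma sum_re_trace_rpow_le {κ ι : Type*} [Fintype κ] [Fintype ι] [DecidableEq ι]
    {W : κ → Matrix ι ι ℂ} (hW : ∀ i, (W i).PosDef ∧ (W i).trace = 1) {B : Matrix ι ι ℂ}
    (hB : B.PosDef) {p : κ → ℝ} (hp : ∀ i, 0 ≤ p i) (hp1 : ∑ i, p i = 1) {t : ℝ}
    (ht0 : 0 ≤ t) :
    0 < ∑ i, p i * (matRpow (W i) (1 - t / (1 + t)) * matRpow B (t / (1 + t))).trace.re ∧
    (∑ i, p i * (matRpow (W i) (1 - t / (1 + t)) * matRpow B (t / (1 + t))).trace.re) ^ (1 + t) ≤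
      ∑ i, p i * (matRpow (W i) (1 - t) * matRpow B t).trace.re := by
  have hH i : (W i).IsHermitian := (hW i).1.isHermitian
  set c : κ × ι × ι → ℝ := fun x =>
    p x.1 * (eigenOverlap (hH x.1) hB.isHermitian x.2.1 x.2.2 * (hH x.1).eigenvalues x.2.1) with hc
  set r : κ × ι × ι → ℝ := fun x =>
    hB.isHermitian.eigenvalues x.2.2 / (hH x.1).eigenvalues x.2.1 with hr
  have hc0 : ∀ x, 0 ≤ c x := fun x => mul_nonneg (hp _)
    (mul_nonneg (eigenOverlap_nonneg _ _ _ _) ((hW _).1.eigenvalues_pos _).le)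
  have hr0 : ∀ x, 0 < r x := fun x =>
    div_pos (hB.eigenvalues_pos _) ((hW _).1.eigenvalues_pos _)
  have hc1 : ∑ x, c x = 1 := by
    rw [Fintype.sum_prod_type, ← hp1]
    refine Finset.sum_congr rfl fun i _ => ?_
    rw [Fintype.sum_prod_type]
    change ∑ a, ∑ b, p i * (eigenOverlap (hH i) hB.isHermitian a b * (hH i).eigenvalues a) = p i
    simp only [← Finset.mul_sum, ← Finset.sum_mul, sum_eigenOverlap_right, one_mul]
    have h := re_trace_matRpow (hH i) 1
    rw [matRpow_one (hH i), (hW i).2] at h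
    simp only [Real.rpow_one, Complex.one_re] at h
    rw [← h, mul_one]
  have hf (s : ℝ) : ∑ i, p i * (matRpow (W i) (1 - s) * matRpow B s).trace.re =
      ∑ x, c x * r x ^ s := by
    simp only [hc, hr, Fintype.sum_prod_type, re_trace_matRpow_mul_matRpow (hH _) hB.isHermitian,
      Finset.mul_sum]
    refine Finset.sum_congr rfl fun i _ => Finset.sum_congr rfl fun a _ =>
      Finset.sum_congr rfl fun b _ => ?_
    have hl := (hW i).1.eigenvalues_pos a
    rw [Real.div_rpow (hB.eigenvalues_pos b).le hl.le, Real.rpow_sub hl, Real.rpow_one]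
    ring
  rw [hf, hf]
  constructor
  · obtain ⟨x, -, hx⟩ : ∃ x ∈ Finset.univ, 0 < c x :=
      Finset.exists_lt_of_sum_lt (by simp [hc1])
    exact Finset.sum_pos' (fun y _ => mul_nonneg (hc0 y) (Real.rpow_pos_of_pos (hr0 y) _).le)
      ⟨x, Finset.mem_univ x, mul_pos hx (Real.rpow_pos_of_pos (hr0 x) _)⟩
  · refine (Real.rpow_arith_mean_le_arith_mean_rpow Finset.univ c (fun x => r x ^ (t / (1 + t)))
      (fun x _ => hc0 x) hc1 (fun x _ => (Real.rpow_pos_of_pos (hr0 x) _).le)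
      (by linarith)).trans_eq ?_
    refine Finset.sum_congr rfl fun x _ => ?_
    rw [← Real.rpow_mul (hr0 x).le, div_mul_cancel₀ _ (by linarith)]

/-- The universal-coding exponent `sup_{0≤t<1} (φ_{W,p}(t) - tR)/(1+t)` is no larger than
the exponent `sup_{0≤t<1} (-log ∑ᵢ pᵢ Tr[W(i)^{1-t} W_pᵗ] - tR)`, where `W_p = ∑ᵢ pᵢ W(i)`. -/
theorem exponent_comparison (k d : ℕ) (W : Fin k → Matrix (Fin d) (Fin d) ℂ)
    (hW : ∀ i, (W i).PosDef ∧ (W i).trace = 1)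
    (p : Fin k → ℝ) (hp : ∀ i, 0 ≤ p i) (hp1 : ∑ i, p i = 1) (R : ℝ) :
    (⨆ t : Set.Ico (0 : ℝ) 1,
        (((phiW W p t.1 - t.1 * R) / (1 + t.1) : ℝ) : EReal)) ≤
      ⨆ t : Set.Ico (0 : ℝ) 1,
        ((-Real.log (∑ i, p i *
            ((matRpow (W i) (1 - t.1) * matRpow (∑ j, (p j : ℂ) • W j) t.1).trace).re)
          - t.1 * R : ℝ) : EReal) := by
  refine iSup_le fun ⟨t, ht0, ht1⟩ => ?_
  have ht : 0 < 1 + t := by linarith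
  have hs : t / (1 + t) ∈ Set.Ico (0 : ℝ) 1 :=
    ⟨by positivity, by rw [div_lt_one ht]; linarith⟩
  refine le_iSup_of_le ⟨t / (1 + t), hs⟩ (EReal.coe_le_coe_iff.2 ?_)
  have hB : (∑ j, (p j : ℂ) • W j).PosDef := posDef_sum_smul (fun i => (hW i).1) hp hp1
  have hB1 : (∑ j, (p j : ℂ) • W j).trace = 1 := by
    simp only [Matrix.trace_sum, Matrix.trace_smul, (hW _).2, smul_eq_mul, mul_one]
    exact_mod_cast hp1
  have : Nonempty (Fin d) := by
    by_contra h
    rw [not_nonempty_iff] at h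
    simp [Matrix.trace] at hB1
  obtain ⟨hf0, hf⟩ := sum_re_trace_rpow_le hW hB hp hp1 ht0
  obtain ⟨hS0, hS⟩ := re_trace_mul_matRpow_le
    (posDef_sum_smul (fun i => posDef_matRpow (hW i).1 (1 - t)) hp hp1) hB hB1 ht0 ht1
  have hlin : ((∑ i, (p i : ℂ) • matRpow (W i) (1 - t)) *
      matRpow (∑ j, (p j : ℂ) • W j) t).trace.re =
      ∑ i, p i * (matRpow (W i) (1 - t) * matRpow (∑ j, (p j : ℂ) • W j) t).trace.re := by
    simp only [Finset.sum_mul (s := Finset.univ), Matrix.trace_sum, Matrix.smul_mul,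
      Matrix.trace_smul, Complex.re_sum, smul_eq_mul, Complex.re_ofReal_mul]
  rw [hlin] at hS
  have h := Real.log_le_log (Real.rpow_pos_of_pos hf0 _) (hf.trans hS)
  rw [Real.log_rpow hf0, Real.log_rpow hS0] at h
  rw [div_le_iff₀ ht, sub_mul, mul_right_comm, div_mul_cancel₀ _ ht.ne', phiW]
  linarith
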